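/- Let (H, μ, Δ, α_H, σ) be a coquasitriangular Hom-bialgebra with α_H bijective and σ = σ∘(α_H⊗α_H), and let (M, α_M), (N, α_N) be left H-comodules. Give M and N the actions h·m := σ(m_{(-1)}⊗α_H(h)) m_{(0)} and h·n := σ(n_{(-1)}⊗α_H(h)) n_{(0)}, and give M⊗N the standard coaction m⊗n ↦ m_{(-1)}n_{(-1)}⊗(m_{(0)}⊗n_{(0)}) together with the induced action h·(m⊗n) := σ(m_{(-1)}n_{(-1)}⊗α_H(h))(m_{(0)}⊗n_{(0)}). Then this induced action coincides with the ⊗̃ action built from the actions on M and N; explicitly, σ(m_{(-1)}n_{(-1)}⊗α_H(h))(m_{(0)}⊗n_{(0)}) = σ(m_{(-1)}⊗α_H^{-1}(h₁)) m_{(0)} ⊗ σ(n_{(-1)}⊗α_H^{-1}(h₂)) n_{(0)} for all h∈H, m∈M, n∈N. -/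

import Mathlib

open TensorProduct

noncomputable section

namespace HomYD

variable (k : Type*) [Field k]
variable {H M N : Type*}
variable [AddCommGroup H] [Module k H]
variable [AddCommGroup M] [Module k M]
variable [AddCommGroup N] [Module k N]

/-- Rearrangement `(a ⊗ b) ⊗ c ↦ (a ⊗ c) ⊗ b`. -/
def rearr (A B C : Type*) [AddCommGroup A] [Module k A] [AddCommGroup B] [Module k B]
    [AddCommGroup C] [Module k C] :
    (A ⊗[k] B) ⊗[k] C →ₗ[k] (A ⊗[k] C) ⊗[k] B :=
  (TensorProduct.assoc k A C B).symm.toLinearMap ∘ₗ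
    (TensorProduct.map LinearMap.id (TensorProduct.comm k B C).toLinearMap) ∘ₗ
      (TensorProduct.assoc k A B C).toLinearMap

/-- Middle-four exchange `(a ⊗ b) ⊗ (c ⊗ d) ↦ (a ⊗ c) ⊗ (b ⊗ d)`. -/
def ttc (A B C D : Type*) [AddCommGroup A] [Module k A] [AddCommGroup B] [Module k B]
    [AddCommGroup C] [Module k C] [AddCommGroup D] [Module k D] :
    (A ⊗[k] B) ⊗[k] (C ⊗[k] D) →ₗ[k] (A ⊗[k] C) ⊗[k] (B ⊗[k] D) :=
  (TensorProduct.tensorTensorTensorComm k A B C D).toLinearMap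

/-- Hom-bialgebra (no unit/counit): multiplicativity of `α`, Hom-associativity,
comultiplicativity of `α`, Hom-coassociativity, and `Δ` multiplicative. -/
structure IsHomBialgebra (μ : H ⊗[k] H →ₗ[k] H) (Δ : H →ₗ[k] H ⊗[k] H)
    (α : H →ₗ[k] H) : Prop where
  mul_mult : ∀ a b : H, α (μ (a ⊗ₜ[k] b)) = μ (α a ⊗ₜ[k] α b)
  hom_assoc : ∀ a b c : H, μ (α a ⊗ₜ[k] μ (b ⊗ₜ[k] c)) = μ (μ (a ⊗ₜ[k] b) ⊗ₜ[k] α c)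
  comul_compat : TensorProduct.map α α ∘ₗ Δ = Δ ∘ₗ α
  hom_coassoc : (TensorProduct.assoc k H H H).toLinearMap ∘ₗ TensorProduct.map Δ α ∘ₗ Δ
      = TensorProduct.map α Δ ∘ₗ Δ
  comul_mul : Δ ∘ₗ μ
      = TensorProduct.map μ μ ∘ₗ ttc k H H H H ∘ₗ TensorProduct.map Δ Δ

/-- Left module over a Hom-(bi)algebra. -/
structure IsHomModule (μ : H ⊗[k] H →ₗ[k] H) (α : H →ₗ[k] H)
    (ρ : H ⊗[k] M →ₗ[k] M) (αM : M →ₗ[k] M) : Prop where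
  str_compat : ∀ (h : H) (m : M), αM (ρ (h ⊗ₜ[k] m)) = ρ (α h ⊗ₜ[k] αM m)
  hom_smul : ∀ (h h' : H) (m : M),
      ρ (α h ⊗ₜ[k] ρ (h' ⊗ₜ[k] m)) = ρ (μ (h ⊗ₜ[k] h') ⊗ₜ[k] αM m)

/-- Left comodule over a Hom-(bi)algebra. -/
structure IsHomComodule (Δ : H →ₗ[k] H ⊗[k] H) (α : H →ₗ[k] H)
    (lM : M →ₗ[k] H ⊗[k] M) (αM : M →ₗ[k] M) : Prop where
  str_compat : TensorProduct.map α αM ∘ₗ lM = lM ∘ₗ αM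
  hom_coact : TensorProduct.map Δ αM ∘ₗ lM
      = (TensorProduct.assoc k H H M).symm.toLinearMap ∘ₗ TensorProduct.map α lM ∘ₗ lM

/-- `h ⊗ m ↦ (h₁·m)₍₋₁₎ β(h₂) ⊗ (h₁·m)₍₀₎`. -/
def ydL (μ : H ⊗[k] H →ₗ[k] H) (Δ : H →ₗ[k] H ⊗[k] H) (β : H →ₗ[k] H)
    (ρ : H ⊗[k] M →ₗ[k] M) (lM : M →ₗ[k] H ⊗[k] M) : H ⊗[k] M →ₗ[k] H ⊗[k] M :=
  TensorProduct.map μ LinearMap.id ∘ₗ rearr k H M H ∘ₗ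
    TensorProduct.map (lM ∘ₗ ρ) β ∘ₗ rearr k H H M ∘ₗ
      TensorProduct.map Δ LinearMap.id

/-- `h ⊗ m ↦ β(h₁) γ(m₍₋₁₎) ⊗ γ(h₂)·m₍₀₎`. -/
def ydR (μ : H ⊗[k] H →ₗ[k] H) (Δ : H →ₗ[k] H ⊗[k] H) (β γ : H →ₗ[k] H)
    (ρ : H ⊗[k] M →ₗ[k] M) (lM : M →ₗ[k] H ⊗[k] M) : H ⊗[k] M →ₗ[k] H ⊗[k] M :=
  TensorProduct.map (μ ∘ₗ TensorProduct.map β γ) (ρ ∘ₗ TensorProduct.map γ LinearMap.id) ∘ₗ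
    ttc k H H H M ∘ₗ TensorProduct.map Δ lM

/-- Yetter-Drinfeld module over a Hom-bialgebra: Hom-module, Hom-comodule and the
compatibility `(h₁·m)₍₋₁₎ α²(h₂) ⊗ (h₁·m)₍₀₎ = α²(h₁) α(m₍₋₁₎) ⊗ α(h₂)·m₍₀₎`. -/
def IsYetterDrinfeld (μ : H ⊗[k] H →ₗ[k] H) (Δ : H →ₗ[k] H ⊗[k] H) (α : H →ₗ[k] H)
    (ρ : H ⊗[k] M →ₗ[k] M) (lM : M →ₗ[k] H ⊗[k] M) (αM : M →ₗ[k] M) : Prop :=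
  IsHomModule k μ α ρ αM ∧ IsHomComodule k Δ α lM αM ∧
    ydL k μ Δ (α ∘ₗ α) ρ lM = ydR k μ Δ (α ∘ₗ α) α ρ lM

/-- `m ⊗ n ↦ αHinv(m₍₋₁₎)·n ⊗ m₍₀₎`. -/
def Bmap (αHinv : H →ₗ[k] H) (lM : M →ₗ[k] H ⊗[k] M) (ρN : H ⊗[k] N →ₗ[k] N) :
    M ⊗[k] N →ₗ[k] N ⊗[k] M :=
  TensorProduct.map (ρN ∘ₗ TensorProduct.map αHinv LinearMap.id) LinearMap.id ∘ₗ
    rearr k H M N ∘ₗ TensorProduct.map lM LinearMap.id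

/-- Quasi-braiding `m ⊗ n ↦ αN⁻¹(αH⁻¹(m₍₋₁₎)·n) ⊗ αM⁻¹(m₍₀₎)`. -/
def braidYD (αH : H ≃ₗ[k] H) (αM : M ≃ₗ[k] M) (αN : N ≃ₗ[k] N)
    (lM : M →ₗ[k] H ⊗[k] M) (ρN : H ⊗[k] N →ₗ[k] N) : M ⊗[k] N →ₗ[k] N ⊗[k] M :=
  TensorProduct.map
      (αN.symm.toLinearMap ∘ₗ ρN ∘ₗ TensorProduct.map αH.symm.toLinearMap LinearMap.id)
      αM.symm.toLinearMap ∘ₗ rearr k H M N ∘ₗ TensorProduct.map lM LinearMap.id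

/-- Action on `M ⊗ N`: `h ⊗ (m ⊗ n) ↦ h₁·m ⊗ h₂·n`. -/
def hatAction (Δ : H →ₗ[k] H ⊗[k] H)
    (ρM : H ⊗[k] M →ₗ[k] M) (ρN : H ⊗[k] N →ₗ[k] N) :
    H ⊗[k] (M ⊗[k] N) →ₗ[k] M ⊗[k] N :=
  TensorProduct.map ρM ρN ∘ₗ ttc k H H M N ∘ₗ TensorProduct.map Δ LinearMap.id

/-- Coaction on `M ⊗ N`: `m ⊗ n ↦ αHinv²(m₍₋₁₎ n₍₋₁₎) ⊗ (m₍₀₎ ⊗ n₍₀₎)`. -/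
def hatCoaction (μ : H ⊗[k] H →ₗ[k] H) (αHinv : H →ₗ[k] H)
    (lM : M →ₗ[k] H ⊗[k] M) (lN : N →ₗ[k] H ⊗[k] N) :
    M ⊗[k] N →ₗ[k] H ⊗[k] (M ⊗[k] N) :=
  TensorProduct.map (αHinv ∘ₗ αHinv ∘ₗ μ) LinearMap.id ∘ₗ ttc k H M H N ∘ₗ
    TensorProduct.map lM lN

/-- Action on `M ⊗ N`: `h ⊗ (m ⊗ n) ↦ αHinv²(h₁)·m ⊗ αHinv²(h₂)·n`. -/
def tildeAction (Δ : H →ₗ[k] H ⊗[k] H) (αHinv : H →ₗ[k] H)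
    (ρM : H ⊗[k] M →ₗ[k] M) (ρN : H ⊗[k] N →ₗ[k] N) :
    H ⊗[k] (M ⊗[k] N) →ₗ[k] M ⊗[k] N :=
  TensorProduct.map ρM ρN ∘ₗ ttc k H H M N ∘ₗ
    TensorProduct.map
      (TensorProduct.map (αHinv ∘ₗ αHinv) (αHinv ∘ₗ αHinv) ∘ₗ Δ) LinearMap.id

/-- Coaction on `M ⊗ N`: `m ⊗ n ↦ m₍₋₁₎ n₍₋₁₎ ⊗ (m₍₀₎ ⊗ n₍₀₎)`. -/
def tildeCoaction (μ : H ⊗[k] H →ₗ[k] H)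
    (lM : M →ₗ[k] H ⊗[k] M) (lN : N →ₗ[k] H ⊗[k] N) :
    M ⊗[k] N →ₗ[k] H ⊗[k] (M ⊗[k] N) :=
  TensorProduct.map μ LinearMap.id ∘ₗ ttc k H M H N ∘ₗ TensorProduct.map lM lN

/-- Associator `(x ⊗ y) ⊗ z ↦ αX⁻¹(x) ⊗ (y ⊗ αZ(z))`. -/
def aYD {X Z : Type*} [AddCommGroup X] [Module k X] [AddCommGroup Z] [Module k Z]
    (αX : X ≃ₗ[k] X) (Y : Type*) [AddCommGroup Y] [Module k Y] (αZ : Z ≃ₗ[k] Z) :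
    (X ⊗[k] Y) ⊗[k] Z →ₗ[k] X ⊗[k] (Y ⊗[k] Z) :=
  (TensorProduct.assoc k X Y Z).toLinearMap ∘ₗ
    TensorProduct.map (TensorProduct.map αX.symm.toLinearMap LinearMap.id) αZ.toLinearMap

/-- Inverse associator `x ⊗ (y ⊗ z) ↦ (αX(x) ⊗ y) ⊗ αZ⁻¹(z)`. -/
def aYDinv {X Z : Type*} [AddCommGroup X] [Module k X] [AddCommGroup Z] [Module k Z]
    (αX : X ≃ₗ[k] X) (Y : Type*) [AddCommGroup Y] [Module k Y] (αZ : Z ≃ₗ[k] Z) :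
    X ⊗[k] (Y ⊗[k] Z) →ₗ[k] (X ⊗[k] Y) ⊗[k] Z :=
  TensorProduct.map (TensorProduct.map αX.toLinearMap LinearMap.id) αZ.symm.toLinearMap ∘ₗ
    (TensorProduct.assoc k X Y Z).symm.toLinearMap

/-- Associator `(x ⊗ y) ⊗ z ↦ αX(x) ⊗ (y ⊗ αZ⁻¹(z))`. -/
def aTilde {X Z : Type*} [AddCommGroup X] [Module k X] [AddCommGroup Z] [Module k Z]
    (αX : X ≃ₗ[k] X) (Y : Type*) [AddCommGroup Y] [Module k Y] (αZ : Z ≃ₗ[k] Z) :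
    (X ⊗[k] Y) ⊗[k] Z →ₗ[k] X ⊗[k] (Y ⊗[k] Z) :=
  (TensorProduct.assoc k X Y Z).toLinearMap ∘ₗ
    TensorProduct.map (TensorProduct.map αX.toLinearMap LinearMap.id) αZ.symm.toLinearMap

/-- Inverse associator `x ⊗ (y ⊗ z) ↦ (αX⁻¹(x) ⊗ y) ⊗ αZ(z)`. -/
def aTildeInv {X Z : Type*} [AddCommGroup X] [Module k X] [AddCommGroup Z] [Module k Z]
    (αX : X ≃ₗ[k] X) (Y : Type*) [AddCommGroup Y] [Module k Y] (αZ : Z ≃ₗ[k] Z) :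
    X ⊗[k] (Y ⊗[k] Z) →ₗ[k] (X ⊗[k] Y) ⊗[k] Z :=
  TensorProduct.map (TensorProduct.map αX.symm.toLinearMap LinearMap.id) αZ.toLinearMap ∘ₗ
    (TensorProduct.assoc k X Y Z).symm.toLinearMap

/-- Quasitriangular Hom-bialgebra. -/
def IsQuasitriangular (μ : H ⊗[k] H →ₗ[k] H) (Δ : H →ₗ[k] H ⊗[k] H) (α : H →ₗ[k] H)
    (R : H ⊗[k] H) : Prop :=
  IsHomBialgebra k μ Δ α ∧
  TensorProduct.map Δ α R
    = TensorProduct.map (TensorProduct.map α α) μ (ttc k H H H H (R ⊗ₜ[k] R)) ∧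
  TensorProduct.map α Δ R
    = TensorProduct.map μ (TensorProduct.map α α ∘ₗ (TensorProduct.comm k H H).toLinearMap)
        (ttc k H H H H (R ⊗ₜ[k] R)) ∧
  ∀ h : H, TensorProduct.map μ μ (ttc k H H H H ((TensorProduct.comm k H H (Δ h)) ⊗ₜ[k] R))
      = TensorProduct.map μ μ (ttc k H H H H (R ⊗ₜ[k] Δ h))

/-- Coaction induced by an R-matrix: `m ↦ α(R²) ⊗ R¹·m`. -/
def coactionFromR (R : H ⊗[k] H) (α : H →ₗ[k] H) (ρM : H ⊗[k] M →ₗ[k] M) :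
    M →ₗ[k] H ⊗[k] M :=
  (TensorProduct.comm k M H).toLinearMap ∘ₗ TensorProduct.map ρM α ∘ₗ rearr k H H M ∘ₗ
    TensorProduct.mk k (H ⊗[k] H) M R

/-- Quasi-braiding from an R-matrix: `m ⊗ n ↦ αN⁻¹(R²·n) ⊗ αM⁻¹(R¹·m)`. -/
def braidR (R : H ⊗[k] H) (ρM : H ⊗[k] M →ₗ[k] M) (ρN : H ⊗[k] N →ₗ[k] N)
    (αM : M ≃ₗ[k] M) (αN : N ≃ₗ[k] N) : M ⊗[k] N →ₗ[k] N ⊗[k] M :=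
  TensorProduct.map αN.symm.toLinearMap αM.symm.toLinearMap ∘ₗ
    (TensorProduct.comm k M N).toLinearMap ∘ₗ TensorProduct.map ρM ρN ∘ₗ
      ttc k H H M N ∘ₗ TensorProduct.mk k (H ⊗[k] H) (M ⊗[k] N) R

/-- Coquasitriangular Hom-bialgebra. -/
def IsCoquasitriangular (μ : H ⊗[k] H →ₗ[k] H) (Δ : H →ₗ[k] H ⊗[k] H) (α : H →ₗ[k] H)
    (σ : H ⊗[k] H →ₗ[k] k) : Prop :=
  IsHomBialgebra k μ Δ α ∧
  (∀ x y z : H, σ (μ (x ⊗ₜ[k] y) ⊗ₜ[k] α z)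
      = LinearMap.mul' k k
          (TensorProduct.map σ σ (ttc k H H H H ((α x ⊗ₜ[k] α y) ⊗ₜ[k] Δ z)))) ∧
  (∀ x y z : H, σ (α x ⊗ₜ[k] μ (y ⊗ₜ[k] z))
      = LinearMap.mul' k k
          (TensorProduct.map σ σ (ttc k H H H H (Δ x ⊗ₜ[k] (α z ⊗ₜ[k] α y))))) ∧
  (∀ x y : H,
      (TensorProduct.rid k H)
        (TensorProduct.map (μ ∘ₗ (TensorProduct.comm k H H).toLinearMap) σ
          (ttc k H H H H (Δ x ⊗ₜ[k] Δ y)))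
      = (TensorProduct.lid k H)
          (TensorProduct.map σ μ (ttc k H H H H (Δ x ⊗ₜ[k] Δ y))))

/-- Action induced by a coquasitriangular form: `h ⊗ m ↦ σ(m₍₋₁₎ ⊗ α(h)) • m₍₀₎`. -/
def actionFromSigma (σ : H ⊗[k] H →ₗ[k] k) (α : H →ₗ[k] H)
    (lM : M →ₗ[k] H ⊗[k] M) : H ⊗[k] M →ₗ[k] M :=
  (TensorProduct.lid k M).toLinearMap ∘ₗ
    TensorProduct.map (σ ∘ₗ TensorProduct.map LinearMap.id α ∘ₗ
        (TensorProduct.comm k H H).toLinearMap) LinearMap.id ∘ₗ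
      (TensorProduct.assoc k H H M).symm.toLinearMap ∘ₗ
        TensorProduct.map LinearMap.id lM

/-- Quasi-braiding from a coquasitriangular form:
`m ⊗ n ↦ σ(n₍₋₁₎ ⊗ m₍₋₁₎) • (αN⁻¹(n₍₀₎) ⊗ αM⁻¹(m₍₀₎))`. -/
def braidSigma (σ : H ⊗[k] H →ₗ[k] k)
    (lM : M →ₗ[k] H ⊗[k] M) (lN : N →ₗ[k] H ⊗[k] N)
    (αM : M ≃ₗ[k] M) (αN : N ≃ₗ[k] N) : M ⊗[k] N →ₗ[k] N ⊗[k] M :=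
  (TensorProduct.lid k (N ⊗[k] M)).toLinearMap ∘ₗ
    TensorProduct.map (σ ∘ₗ (TensorProduct.comm k H H).toLinearMap)
      (TensorProduct.map αN.symm.toLinearMap αM.symm.toLinearMap ∘ₗ
        (TensorProduct.comm k M N).toLinearMap) ∘ₗ
      ttc k H M H N ∘ₗ TensorProduct.map lM lN


@[simp]
theorem ttc_tmul {A B C D : Type*} [AddCommGroup A] [Module k A] [AddCommGroup B] [Module k B]
    [AddCommGroup C] [Module k C] [AddCommGroup D] [Module k D] (a : A) (b : B) (c : C) (d : D) :
    ttc k A B C D ((a ⊗ₜ[k] b) ⊗ₜ[k] (c ⊗ₜ[k] d)) = (a ⊗ₜ[k] c) ⊗ₜ[k] (b ⊗ₜ[k] d) :=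
  rfl

/-- Contraction of the first tensor factor against a functional: `a ⊗ x ↦ f(a) • x`. -/
def contract {A X : Type*} [AddCommGroup A] [Module k A] [AddCommGroup X] [Module k X]
    (f : A →ₗ[k] k) : A ⊗[k] X →ₗ[k] X :=
  (TensorProduct.lid k X).toLinearMap ∘ₗ f.rTensor X

section contract

variable {A B X Y : Type*} [AddCommGroup A] [Module k A] [AddCommGroup B] [Module k B]
  [AddCommGroup X] [Module k X] [AddCommGroup Y] [Module k Y]

@[simp]
theorem contract_tmul (f : A →ₗ[k] k) (a : A) (x : X) :
    contract k f (a ⊗ₜ[k] x) = f a • x := by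
  simp [contract]

theorem contract_zero : contract k (X := X) (0 : A →ₗ[k] k) = 0 := by
  ext; simp

theorem contract_add (f g : A →ₗ[k] k) :
    contract k (X := X) (f + g) = contract k f + contract k g := by
  ext; simp [add_smul]

theorem contract_map_id (f : B →ₗ[k] k) (g : A →ₗ[k] B) (t : A ⊗[k] X) :
    contract k f (TensorProduct.map g LinearMap.id t) = contract k (f ∘ₗ g) t := by
  induction t with
  | zero => simp
  | add u v hu hv => simp only [map_add, hu, hv]
  | tmul a x => simp

theorem contract_tmul_contract (f : A →ₗ[k] k) (g : B →ₗ[k] k) (u : A ⊗[k] X) (v : B ⊗[k] Y) :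
    contract k f u ⊗ₜ[k] contract k g v
      = contract k (LinearMap.mul' k k ∘ₗ TensorProduct.map f g) (ttc k A X B Y (u ⊗ₜ[k] v)) := by
  induction u with
  | zero => simp
  | add u u' hu hu' => simp only [map_add, add_tmul, hu, hu']
  | tmul a x =>
    induction v with
    | zero => simp
    | add v v' hv hv' => simp only [map_add, tmul_add, hv, hv']
    | tmul b y => simp [← smul_tmul', smul_smul, mul_comm]

end contract

theorem actionFromSigma_tmul (σ : H ⊗[k] H →ₗ[k] k) (α : H →ₗ[k] H) (lM : M →ₗ[k] H ⊗[k] M)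
    (h : H) (m : M) :
    actionFromSigma k σ α lM (h ⊗ₜ[k] m)
      = contract k (σ ∘ₗ (TensorProduct.mk k H H).flip (α h)) (lM m) := by
  simp only [actionFromSigma, LinearMap.comp_apply, TensorProduct.map_tmul, LinearMap.id_apply]
  induction lM m with
  | zero => simp
  | add u v hu hv => simp only [tmul_add, map_add, hu, hv]
  | tmul a m' => simp

/-- The functional `a ⊗ b ↦ σ(α(a) ⊗ w₁) σ(α(b) ⊗ w₂)` on `H ⊗ H` attached to `w = w₁ ⊗ w₂`. -/
def sigmaPairing (σ : H ⊗[k] H →ₗ[k] k) (α : H →ₗ[k] H) :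
    H ⊗[k] H →ₗ[k] H ⊗[k] H →ₗ[k] k :=
  (TensorProduct.mk k (H ⊗[k] H) (H ⊗[k] H)).flip.compr₂
      (LinearMap.mul' k k ∘ₗ TensorProduct.map σ σ ∘ₗ ttc k H H H H) |>.compl₂
    (TensorProduct.map α α)

@[simp]
theorem sigmaPairing_apply_tmul (σ : H ⊗[k] H →ₗ[k] k) (α : H →ₗ[k] H) (w : H ⊗[k] H) (a b : H) :
    sigmaPairing k σ α w (a ⊗ₜ[k] b)
      = LinearMap.mul' k k
          (TensorProduct.map σ σ (ttc k H H H H ((α a ⊗ₜ[k] α b) ⊗ₜ[k] w))) :=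
  rfl

theorem tildeAction_actionFromSigma_tmul (Δ : H →ₗ[k] H ⊗[k] H) (αH : H ≃ₗ[k] H)
    (σ : H ⊗[k] H →ₗ[k] k)
    (hσ : σ ∘ₗ TensorProduct.map αH.toLinearMap αH.toLinearMap = σ)
    (lM : M →ₗ[k] H ⊗[k] M) (lN : N →ₗ[k] H ⊗[k] N) (h : H) (m : M) (n : N) :
    tildeAction k Δ αH.symm.toLinearMap (actionFromSigma k σ αH.toLinearMap lM)
        (actionFromSigma k σ αH.toLinearMap lN) (h ⊗ₜ[k] (m ⊗ₜ[k] n))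
      = contract k (sigmaPairing k σ αH.toLinearMap (Δ h))
          (ttc k H M H N (lM m ⊗ₜ[k] lN n)) := by
  have hσ_symm (a z : H) : σ (a ⊗ₜ[k] αH.symm z) = σ (αH a ⊗ₜ[k] z) := by
    simpa using (LinearMap.congr_fun hσ (a ⊗ₜ[k] αH.symm z)).symm
  simp only [tildeAction, LinearMap.comp_apply, TensorProduct.map_tmul, LinearMap.id_apply]
  induction Δ h with
  | zero => simp [contract_zero]
  | add w w' hw hw' =>
    simp only [map_add, add_tmul, hw, hw', contract_add, LinearMap.add_apply]
  | tmul x y =>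
    simp only [TensorProduct.map_tmul, ttc_tmul, actionFromSigma_tmul, contract_tmul_contract]
    congr 2
    ext a b
    simp [hσ_symm]

theorem actionFromSigma_tildeCoaction_tmul (μ : H ⊗[k] H →ₗ[k] H) (Δ : H →ₗ[k] H ⊗[k] H)
    (α : H →ₗ[k] H) (σ : H ⊗[k] H →ₗ[k] k) (hCQT : IsCoquasitriangular k μ Δ α σ)
    (lM : M →ₗ[k] H ⊗[k] M) (lN : N →ₗ[k] H ⊗[k] N) (h : H) (m : M) (n : N) :
    actionFromSigma k σ α (tildeCoaction k μ lM lN) (h ⊗ₜ[k] (m ⊗ₜ[k] n))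
      = contract k (sigmaPairing k σ α (Δ h)) (ttc k H M H N (lM m ⊗ₜ[k] lN n)) := by
  simp only [actionFromSigma_tmul, tildeCoaction, LinearMap.comp_apply, TensorProduct.map_tmul,
    contract_map_id]
  congr 2
  ext a b
  simpa using hCQT.2.1 a b h

/-- for comodules over a coquasitriangular Hom-bialgebra (with `αH`
bijective and `σ = σ ∘ (α ⊗ α)`), the σ-action induced by the tensor product coaction on
`M ⊗ N` coincides with the ⊗̃ action built from the σ-actions of `M` and `N`. -/
theorem stmt18 {k H M N : Type*} [Field k]
    [AddCommGroup H] [Module k H] [AddCommGroup M] [Module k M] [AddCommGroup N] [Module k N]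
    (μ : H ⊗[k] H →ₗ[k] H) (Δ : H →ₗ[k] H ⊗[k] H) (αH : H ≃ₗ[k] H)
    (σ : H ⊗[k] H →ₗ[k] k)
    (hCQT : IsCoquasitriangular k μ Δ αH.toLinearMap σ)
    (hσ : σ ∘ₗ TensorProduct.map αH.toLinearMap αH.toLinearMap = σ)
    (lM : M →ₗ[k] H ⊗[k] M) (αM : M →ₗ[k] M)
    (hM : IsHomComodule k Δ αH.toLinearMap lM αM)
    (lN : N →ₗ[k] H ⊗[k] N) (αN : N →ₗ[k] N)
    (hN : IsHomComodule k Δ αH.toLinearMap lN αN) :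
    actionFromSigma k σ αH.toLinearMap (tildeCoaction k μ lM lN)
      = tildeAction k Δ αH.symm.toLinearMap
          (actionFromSigma k σ αH.toLinearMap lM)
          (actionFromSigma k σ αH.toLinearMap lN) := by
  ext h m n
  exact (actionFromSigma_tildeCoaction_tmul k μ Δ αH.toLinearMap σ hCQT lM lN h m n).trans
    (tildeAction_actionFromSigma_tmul k Δ αH σ hσ lM lN h m n).symm

end HomYD
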